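/- arXiv:2601.22066 — 3 statements merged into one kernel-verified Lean document; each statement's English description precedes it below -/
import Mathlib

section
/- In an exact couple (D, E, i, j, k) over a field F and for an integer r ≥ 0, there exists an F-linear isomorphism φ : Z^(r)/Z^(r+1) → B^(r+1)/B^(r) such that for every α ∈ Z^(r) and every x ∈ D with k(α) = i^r(x), one has φ([α]) = [j(x)] (note that then i^(r+1)(x) = i(k(α)) = 0, so j(x) ∈ B^(r+1)). In other words, the differential d^(r) induces an isomorphism Z^(r)/Z^(r+1) ≅ B^(r+1)/B^(r). -/
/-- In an exact couple `(D, E, i, j, k)` over a field `F` and for an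
integer `r ≥ 0`, there exists an `F`-linear isomorphism
`φ : Z^(r)/Z^(r+1) → B^(r+1)/B^(r)` such that for every `α ∈ Z^(r)` and every
`x ∈ D` with `k(α) = i^r(x)`, one has `φ([α]) = [j(x)]` (note that then
`i^(r+1)(x) = i(k(α)) = 0`, so `j(x) ∈ B^(r+1)`).  In other words, the differential
`d^(r)` induces an isomorphism `Z^(r)/Z^(r+1) ≅ B^(r+1)/B^(r)`. -/
theorem exact_couple_derived_differential_iso
    (F : Type*) [Field F] (D E : Type*)
    [AddCommGroup D] [Module F D] [AddCommGroup E] [Module F E]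
    (i : D →ₗ[F] D) (j : D →ₗ[F] E) (k : E →ₗ[F] D)
    (hij : LinearMap.range i = LinearMap.ker j)
    (hjk : LinearMap.range j = LinearMap.ker k)
    (hki : LinearMap.range k = LinearMap.ker i)
    (r : ℕ) :
    ∃ φ : (Submodule.comap k (LinearMap.range (i ^ r)) ⧸
             (Submodule.comap k (LinearMap.range (i ^ (r + 1)))).comap
               (Submodule.comap k (LinearMap.range (i ^ r))).subtype) ≃ₗ[F]
          (Submodule.map j (LinearMap.ker (i ^ (r + 1))) ⧸
             (Submodule.map j (LinearMap.ker (i ^ r))).comap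
               (Submodule.map j (LinearMap.ker (i ^ (r + 1)))).subtype),
      ∀ (α : Submodule.comap k (LinearMap.range (i ^ r))) (x : D),
        k (α : E) = (i ^ r) x →
        ∀ hjx : j x ∈ Submodule.map j (LinearMap.ker (i ^ (r + 1))),
          φ (Submodule.Quotient.mk α) = Submodule.Quotient.mk ⟨j x, hjx⟩ := by
  have pow_succ_apply (x : D) : (i ^ (r + 1)) x = i ((i ^ r) x) := by
    rw [pow_succ']; rfl
  have pow_succ_apply' (x : D) : (i ^ (r + 1)) x = (i ^ r) (i x) := by
    rw [pow_succ]; rfl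
  have mem_ker (e : E) (x : D) (h : k e = (i ^ r) x) : x ∈ LinearMap.ker (i ^ (r + 1)) := by
    rw [LinearMap.mem_ker, pow_succ_apply, ← h, ← LinearMap.mem_ker, ← hki]
    exact ⟨e, rfl⟩
  obtain ⟨s, hs⟩ := (i ^ r).rangeRestrict.exists_rightInverse_of_surjective
    (LinearMap.range_rangeRestrict _)
  have i_pow_s (y : LinearMap.range (i ^ r)) : (i ^ r) (s y) = y :=
    congrArg Subtype.val (LinearMap.congr_fun hs y)
  let kRestrict : Submodule.comap k (LinearMap.range (i ^ r)) →ₗ[F] LinearMap.range (i ^ r) :=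
    k.restrict fun _ h => h
  let lift : Submodule.comap k (LinearMap.range (i ^ r)) →ₗ[F]
      Submodule.map j (LinearMap.ker (i ^ (r + 1))) :=
    (j ∘ₗ s ∘ₗ kRestrict).codRestrict _ fun α =>
      Submodule.mem_map_of_mem (mem_ker α _ (i_pow_s (kRestrict α)).symm)
  let d := ((Submodule.map j (LinearMap.ker (i ^ r))).comap
    (Submodule.map j (LinearMap.ker (i ^ (r + 1)))).subtype).mkQ ∘ₗ lift
  have d_apply (α : Submodule.comap k (LinearMap.range (i ^ r))) (x : D)
      (h : k (α : E) = (i ^ r) x)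
      (hjx : j x ∈ Submodule.map j (LinearMap.ker (i ^ (r + 1)))) :
      d α = Submodule.Quotient.mk ⟨j x, hjx⟩ := by
    refine (Submodule.Quotient.eq _).2 ⟨s (kRestrict α) - x, ?_, map_sub j _ _⟩
    have h' : (i ^ r) (s (kRestrict α)) = k α := i_pow_s _
    exact LinearMap.mem_ker.2 (by rw [map_sub, h', h, sub_self])
  have ker_d : (Submodule.comap k (LinearMap.range (i ^ (r + 1)))).comap
      (Submodule.comap k (LinearMap.range (i ^ r))).subtype = LinearMap.ker d := by
    ext α
    obtain ⟨x, hx⟩ := α.2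
    have hjx := Submodule.mem_map_of_mem (f := j) (mem_ker α x hx.symm)
    rw [LinearMap.mem_ker]
    constructor
    · rintro ⟨z, hz⟩
      have hjz : j (i z) = 0 := by
        rw [← LinearMap.mem_ker, ← hij]
        exact ⟨z, rfl⟩
      have h : k (α : E) = (i ^ r) (i z) := by
        rw [← pow_succ_apply']
        exact hz.symm
      rw [d_apply α (i z) h (hjz ▸ Submodule.zero_mem _), Submodule.Quotient.mk_eq_zero]
      change j (i z) ∈ Submodule.map j (LinearMap.ker (i ^ r))
      exact hjz ▸ Submodule.zero_mem _
    · intro h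
      rw [d_apply α x hx.symm hjx, Submodule.Quotient.mk_eq_zero] at h
      obtain ⟨y, hy, hyx⟩ := h
      have hyx' : x - y ∈ LinearMap.range i := by
        rw [hij, LinearMap.mem_ker, map_sub, sub_eq_zero]
        exact hyx.symm
      obtain ⟨z, hz⟩ := hyx'
      refine ⟨z, ?_⟩
      rw [pow_succ_apply', hz, map_sub, LinearMap.mem_ker.1 hy, sub_zero]
      exact hx
  have d_surjective : Function.Surjective d := by
    intro b
    obtain ⟨⟨_, x, hx, rfl⟩, rfl⟩ := Submodule.Quotient.mk_surjective _ b
    have hk : (i ^ r) x ∈ LinearMap.range k := by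
      rw [hki, LinearMap.mem_ker, ← pow_succ_apply]
      exact hx
    obtain ⟨e, he⟩ := hk
    exact ⟨⟨e, x, he.symm⟩, d_apply _ x he _⟩
  exact ⟨(Submodule.quotEquivOfEq _ _ ker_d).trans (d.quotKerEquivOfSurjective d_surjective),
    d_apply⟩
end

section
/- Let F be a field and n ≥ 0 an integer. Suppose given finite-dimensional F-vector spaces D_{p,q} and E_{p,q} for all p, q ∈ ℤ, and F-linear maps i_{p,q} : D_{p,q} → D_{p+1,q-1}, j_{p,q} : D_{p,q} → E_{p,q}, k_{p,q} : E_{p,q} → D_{p-1,q}, such that: (a) for all p, q the sequences are exact, i.e. range(i_{p-1,q+1}) = ker(j_{p,q}), range(j_{p,q}) = ker(k_{p,q}), and range(k_{p,q}) = ker(i_{p-1,q}); (b) D_{p,q} = 0 whenever p < 0, and E_{p,q} = 0 whenever p < 0 or p > n, and for each m ∈ ℤ only finitely many of the spaces E_{p,m-p} and D_{p,m-p} are nonzero; (c) i_{p,q} is an isomorphism whenever p ≥ n. Then there exists a chain complex C_• of finite-dimensional F-vector spaces indexed by ℤ (with differentials ∂_m : C_m → C_{m-1} satisfying ∂_{m-1}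 ∘ ∂_m = 0) such that for every m ∈ ℤ: (i) dim_F(C_m) = Σ_{p=0}^{n} dim_F(E_{p,m-p}), and (ii) the m-th homology H_m(C_•) = ker(∂_m)/range(∂_{m+1}) is isomorphic to D_{n,m-n}. -/
open CategoryTheory

/-- In an exact couple, the Euler-characteristic count of two consecutive `D`-terms and the
`E`-term between them, with the kernels of `i` as correction terms. -/
theorem finrank_add_finrank_ker_of_exact {F V W E D₁ D₂ : Type*} [Field F]
    [AddCommGroup V] [Module F V] [AddCommGroup W] [Module F W] [AddCommGroup E] [Module F E]
    [AddCommGroup D₁] [Module F D₁] [AddCommGroup D₂] [Module F D₂]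
    [FiniteDimensional F V] [FiniteDimensional F W] [FiniteDimensional F E]
    (f : V →ₗ[F] W) (j : W →ₗ[F] E) (k : E →ₗ[F] D₁) (g : D₁ →ₗ[F] D₂)
    (hfj : LinearMap.range f = LinearMap.ker j) (hjk : LinearMap.range j = LinearMap.ker k)
    (hkg : LinearMap.range k = LinearMap.ker g) :
    Module.finrank F W + Module.finrank F (LinearMap.ker f) +
        Module.finrank F (LinearMap.ker g) =
      Module.finrank F V + Module.finrank F E := by
  have hf := f.finrank_range_add_finrank_ker
  have hj := j.finrank_range_add_finrank_ker
  have hk := k.finrank_range_add_finrank_ker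
  rw [hfj] at hf
  rw [hjk] at hj
  rw [hkg] at hk
  omega

/-- The telescoping sum of a relation between consecutive terms on the antidiagonals. -/
theorem add_sum_ker_eq_sum (d e κ : ℤ → ℤ → ℕ) (hd : ∀ q, d (-1) q = 0)
    (h : ∀ p q, d p q + κ (p - 1) (q + 1) + κ (p - 1) q = d (p - 1) (q + 1) + e p q)
    (n : ℕ) (m : ℤ) :
    d n (m - n) + ∑ p ∈ Finset.range (n + 1), κ ((p : ℤ) - 1) (m - p) +
        ∑ p ∈ Finset.range (n + 1), κ ((p : ℤ) - 1) (m + 1 - p) =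
      ∑ p ∈ Finset.range (n + 1), e p (m - p) := by
  induction n with
  | zero =>
    have := h 0 m
    have := hd (m + 1)
    simp at *
    omega
  | succ n ih =>
    have h' := h (n + 1 : ℕ) (m - (n + 1 : ℕ))
    rw [Finset.sum_range_succ _ (n + 1), Finset.sum_range_succ _ (n + 1),
      Finset.sum_range_succ _ (n + 1)]
    have e₁ : m - ((n + 1 : ℕ) : ℤ) + 1 = m + 1 - (n + 1 : ℕ) := by ring
    have e₂ : d (((n + 1 : ℕ) : ℤ) - 1) (m + 1 - (n + 1 : ℕ)) = d n (m - n) := by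
      congr 1 <;> push_cast <;> ring
    rw [e₁, e₂] at h'
    omega

/-- The homology of a short complex of modules, identified by a surjection from the cycles whose
kernel consists of the boundaries. -/
theorem nonempty_homology_linearEquiv {R : Type} [Ring R] (S : ShortComplex (ModuleCat.{0} R))
    {V : Type} [AddCommGroup V] [Module R V] (f : LinearMap.ker S.g.hom →ₗ[R] V)
    (hf : Function.Surjective f) (hker : LinearMap.ker f = LinearMap.range S.moduleCatToCycles) :
    Nonempty (S.homology ≃ₗ[R] V) :=
  ⟨S.moduleCatHomologyIso.toLinearEquiv.trans
    ((Submodule.quotEquivOfEq _ _ hker.symm).trans (f.quotKerEquivOfSurjective hf))⟩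

section SplitComplex

variable (F : Type) [Field F] (H : ℤ → Type) [∀ m, AddCommGroup (H m)] [∀ m, Module F (H m)]
  (r : ℤ → ℕ)

/-- The differential `(a, b, c) ↦ (0, 0, b)` of `splitComplex`. -/
def splitDifferential (m : ℤ) :
    (H (m + 1) × (Fin (r (m + 1)) → F) × (Fin (r (m + 1 + 1)) → F)) →ₗ[F]
      (H m × (Fin (r m) → F) × (Fin (r (m + 1)) → F)) :=
  LinearMap.inr F _ _ ∘ₗ LinearMap.inr F _ _ ∘ₗ LinearMap.fst F _ _ ∘ₗ LinearMap.snd F _ _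

/-- The chain complex of vector spaces with homology `H m` in degree `m` and differentials
`C (m + 1) ⟶ C m` of rank `r (m + 1)`. -/
noncomputable def splitComplex : ChainComplex (ModuleCat.{0} F) ℤ :=
  ChainComplex.of (fun m => ModuleCat.of F (H m × (Fin (r m) → F) × (Fin (r (m + 1)) → F)))
    (fun m => ModuleCat.ofHom (splitDifferential F H r m))
    (fun m => by
      rw [← ModuleCat.ofHom_comp]
      rfl)

theorem nonempty_homology_splitComplex (m : ℤ) :
    Nonempty ((splitComplex F H r).homology m ≃ₗ[F] H m) := by
  obtain ⟨l, rfl⟩ : ∃ l, m = l + 1 := ⟨m - 1, by ring⟩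
  let S := ShortComplex.mk (ModuleCat.ofHom (splitDifferential F H r (l + 1)))
    (ModuleCat.ofHom (splitDifferential F H r l)) (by
      rw [← ModuleCat.ofHom_comp]
      rfl)
  have hS : (splitComplex F H r).sc' (l + 1 + 1) (l + 1) l = S := by
    simp only [HomologicalComplex.sc', HomologicalComplex.shortComplexFunctor', splitComplex,
      ChainComplex.of_d]
    rfl
  let φ : (splitComplex F H r).homology (l + 1) ≅ S.homology :=
    ShortComplex.homologyMapIso
      ((splitComplex F H r).isoSc' (l + 1 + 1) (l + 1) l (by simp) (by simp) ≪≫ eqToIso hS)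
  obtain ⟨ψ⟩ := nonempty_homology_linearEquiv S
    (LinearMap.fst F (H (l + 1)) _ ∘ₗ (LinearMap.ker S.g.hom).subtype)
    (fun a => ⟨⟨(a, 0, 0), rfl⟩, rfl⟩) (by
      ext ⟨⟨a, b, c⟩, hx⟩
      have hb : b = 0 := congrArg (fun z => z.2.2) hx
      subst hb
      constructor
      · intro ha
        have ha : a = 0 := ha
        subst ha
        exact ⟨(0, c, 0), rfl⟩
      · rintro ⟨y, hy⟩
        exact (congrArg (fun z => z.1.1) hy).symm)
  exact ⟨φ.toLinearEquiv.trans ψ⟩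

end SplitComplex


/-- Given a bounded exact couple of finite total dimension over a
field `F`, presented in bigraded form with maps `i, j, k` of bidegrees `(1,−1)`,
`(0,0)`, `(−1,0)`, such that `D_{p,q} = 0` for `p < 0`, `E_{p,q} = 0` for `p < 0` or
`p > n`, each diagonal contains only finitely many nonzero terms, and `i_{p,q}` is an
isomorphism for `p ≥ n` (so `D_{n,m-n}` is the direct limit `H_m` on the `m`-th
diagonal), there exists a chain complex `C_•` of finite-dimensional `F`-vector
spaces, indexed by `ℤ`, with `dim C_m = Σ_{p=0}^{n} dim E_{p,m-p}` and
`H_m(C_•) ≅ D_{n,m-n}` for all `m`. -/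
theorem exact_couple_chain_complex_exists
    (F : Type) [Field F] (n : ℕ)
    (D E : ℤ → ℤ → Type)
    [∀ p q, AddCommGroup (D p q)] [∀ p q, Module F (D p q)]
    [∀ p q, AddCommGroup (E p q)] [∀ p q, Module F (E p q)]
    [∀ p q, FiniteDimensional F (D p q)] [∀ p q, FiniteDimensional F (E p q)]
    (i : ∀ p q : ℤ, D p q →ₗ[F] D (p + 1) (q - 1))
    (j : ∀ p q : ℤ, D p q →ₗ[F] E p q)
    (k : ∀ p q : ℤ, E p q →ₗ[F] D (p - 1) q)
    -- (a) exactness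
    (ha₁ : ∀ p q : ℤ, LinearMap.range (i p q) = LinearMap.ker (j (p + 1) (q - 1)))
    (ha₂ : ∀ p q : ℤ, LinearMap.range (j p q) = LinearMap.ker (k p q))
    (ha₃ : ∀ p q : ℤ, LinearMap.range (k p q) = LinearMap.ker (i (p - 1) q))
    -- (b) boundedness
    (hD : ∀ p q : ℤ, p < 0 → Subsingleton (D p q))
    (hE : ∀ p q : ℤ, p < 0 ∨ (n : ℤ) < p → Subsingleton (E p q))
    (hfinD : ∀ m : ℤ, {p : ℤ | ¬ Subsingleton (D p (m - p))}.Finite)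
    (hfinE : ∀ m : ℤ, {p : ℤ | ¬ Subsingleton (E p (m - p))}.Finite)
    -- (c) stabilization of the D-terms
    (hc : ∀ p q : ℤ, (n : ℤ) ≤ p → Function.Bijective (i p q)) :
    ∃ C : ChainComplex (ModuleCat.{0} F) ℤ,
      (∀ m : ℤ, FiniteDimensional F (C.X m)) ∧
      (∀ m : ℤ, Module.finrank F (C.X m) =
        ∑ p ∈ Finset.range (n + 1), Module.finrank F (E (p : ℤ) (m - (p : ℤ)))) ∧
      (∀ m : ℤ, Nonempty ((C.homology m) ≃ₗ[F] D (n : ℤ) (m - (n : ℤ)))) := by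
  let κ : ℤ → ℤ → ℕ := fun p q => Module.finrank F (LinearMap.ker (i p q))
  let r : ℤ → ℕ := fun m => ∑ p ∈ Finset.range (n + 1), κ ((p : ℤ) - 1) (m - p)
  let H : ℤ → Type := fun m => D n (m - n)
  let _ : ∀ m, AddCommGroup (H m) := fun m => inferInstanceAs (AddCommGroup (D n (m - n)))
  let _ : ∀ m, Module F (H m) := fun m => inferInstanceAs (Module F (D n (m - n)))
  have _ : ∀ m, FiniteDimensional F (H m) :=
    fun m => inferInstanceAs (FiniteDimensional F (D n (m - n)))
  have hstep : ∀ p q, Module.finrank F (D p q) + κ (p - 1) (q + 1) + κ (p - 1) q =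
      Module.finrank F (D (p - 1) (q + 1)) + Module.finrank F (E p q) := by
    intro p q
    obtain ⟨p, rfl⟩ : ∃ p', p = p' + 1 := ⟨p - 1, by ring⟩
    obtain ⟨q, rfl⟩ : ∃ q', q = q' - 1 := ⟨q + 1, by ring⟩
    have h := finrank_add_finrank_ker_of_exact (i p q) (j _ _) (k _ _) (i _ _)
      (ha₁ p q) (ha₂ _ _) (ha₃ _ _)
    have hp : p + 1 - 1 = p := by ring
    have hq : q - 1 + 1 = q := by ring
    have hκ : κ (p + 1 - 1) (q - 1 + 1) = κ p q := by rw [hp, hq]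
    have hdim : Module.finrank F (D (p + 1 - 1) (q - 1 + 1)) = Module.finrank F (D p q) := by
      rw [hp, hq]
    rw [hκ, hdim]
    exact h
  have hzero : ∀ q, Module.finrank F (D (-1) q) = 0 := fun q =>
    have := hD (-1) q (by norm_num)
    Module.finrank_zero_of_subsingleton
  refine ⟨splitComplex F H r, fun m => ?_, fun m => ?_, nonempty_homology_splitComplex F H r⟩
  · exact inferInstanceAs
      (FiniteDimensional F (H m × (Fin (r m) → F) × (Fin (r (m + 1)) → F)))
  · rw [← add_sum_ker_eq_sum (fun p q => Module.finrank F (D p q))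
      (fun p q => Module.finrank F (E p q)) κ hzero hstep n m]
    have h : Module.finrank F (H m × (Fin (r m) → F) × (Fin (r (m + 1)) → F)) =
        Module.finrank F (H m) + r m + r (m + 1) := by
      simp [add_assoc]
    exact h
end

section
/- Let F be a field. For the torus S^1 × S^1 (product of two copies of the unit circle S^1 ⊆ ℝ²), the singular homology with coefficients in F satisfies: H_0(S^1 × S^1; F) ≅ F, H_1(S^1 × S^1; F) ≅ F ⊕ F, H_2(S^1 × S^1; F) ≅ F, and H_r(S^1 × S^1; F) = 0 for all r ≥ 3. -/
open CategoryTheory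

/-- The singular chain complex of a topological space `X` with coefficients in `F`:
the alternating face map complex of the free simplicial `F`-module on the singular
simplicial set of `X`. -/
noncomputable def singularChainComplex (F : Type) [Field F]
    (X : Type) [TopologicalSpace X] : ChainComplex (ModuleCat F) ℕ :=
  (AlgebraicTopology.alternatingFaceMapComplex (ModuleCat F)).obj
    (((SimplicialObject.whiskering _ _).obj (ModuleCat.free F)).obj
      (TopCat.toSSet.obj (TopCat.of X)))

/-- The `r`-th singular homology of `X` with coefficients in `F`. -/
noncomputable def singularHomology (F : Type) [Field F]
    (X : Type) [TopologicalSpace X] (r : ℕ) : ModuleCat F :=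
  (singularChainComplex F X).homology r

section Algebra

variable {F S Q : Type*} [Field F] {t : S → S} {π : S → Q}

lemma Finsupp.injective_id_sub_lmapDomain (ht : Function.Injective t)
    (hfree : ∀ s, Function.Injective fun k : ℕ ↦ t^[k] s) :
    Function.Injective (LinearMap.id - Finsupp.lmapDomain F F t : (S →₀ F) →ₗ[F] S →₀ F) := by
  rw [← LinearMap.ker_eq_bot, LinearMap.ker_eq_bot']
  intro x hx
  have hx' : x.mapDomain t = x := by
    simpa [sub_eq_zero, eq_comm] using hx
  have hinv (s : S) : x (t s) = x s := by
    conv_lhs => rw [← hx', Finsupp.mapDomain_apply ht]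
  have hiter (s : S) (k : ℕ) : x (t^[k] s) = x s := by
    induction k with
    | zero => rfl
    | succ k ih => rw [Function.iterate_succ_apply', hinv, ih]
  ext s
  by_contra hs
  refine Set.infinite_range_of_injective (hfree s) (x.support.finite_toSet.subset ?_)
  rintro _ ⟨k, rfl⟩
  simpa [hiter] using hs

lemma Finsupp.exact_id_sub_lmapDomain (hπ : Function.Surjective π) (hπt : ∀ s, π (t s) = π s)
    (hfib : ∀ a b, π a = π b → ∃ k : ℕ, t^[k] a = b ∨ t^[k] b = a) :
    Function.Exact (LinearMap.id - Finsupp.lmapDomain F F t : (S →₀ F) →ₗ[F] S →₀ F)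
      (Finsupp.lmapDomain F F π) := by
  set D : (S →₀ F) →ₗ[F] S →₀ F := LinearMap.id - Finsupp.lmapDomain F F t with hD
  have hstep (s : S) (k : ℕ) (c : F) :
      single s c - single (t^[k] s) c ∈ LinearMap.range D := by
    induction k with
    | zero => simp
    | succ k ih =>
      have h : single (t^[k] s) c - single (t^[k + 1] s) c ∈ LinearMap.range D :=
        ⟨single (t^[k] s) c, by simp [hD, Function.iterate_succ_apply']⟩
      simpa using add_mem ih h
  have hpair (a b : S) (hab : π a = π b) (c : F) :
      single a c - single b c ∈ LinearMap.range D := by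
    obtain ⟨k, rfl | rfl⟩ := hfib a b hab
    · exact hstep a k c
    · simpa using neg_mem (hstep b k c)
  have hσ (x : S →₀ F) :
      x - (x.mapDomain π).mapDomain (Function.surjInv hπ) ∈ LinearMap.range D := by
    induction x using Finsupp.induction_linear with
    | zero => simp
    | add x y hx hy =>
      simpa only [mapDomain_add, add_sub_add_comm] using add_mem hx hy
    | single s c =>
      simpa only [mapDomain_single] using hpair _ _ (Function.surjInv_eq hπ _).symm c
  intro x
  constructor
  · intro hx
    rw [lmapDomain_apply] at hx
    simpa [hx] using hσ x
  · rintro ⟨y, rfl⟩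
    have : π ∘ t = π := funext hπt
    rw [hD, LinearMap.sub_apply, map_sub, LinearMap.id_apply, lmapDomain_apply, lmapDomain_apply,
      lmapDomain_apply, ← mapDomain_comp, this, sub_self]

end Algebra

section Lifting

lemma IsCoveringMap.exists_lift_of_contractibleSpace {A E X : Type*} [TopologicalSpace A]
    [TopologicalSpace E] [TopologicalSpace X] [ContractibleSpace A] {p : E → X}
    (cov : IsCoveringMap p) (hp : Function.Surjective p) (f : C(A, X)) :
    ∃ g : C(A, E), ∀ a, p (g a) = f a := by
  obtain ⟨a₀, ⟨H⟩⟩ := id_nullhomotopic A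
  obtain ⟨e, he⟩ := hp (f a₀)
  let K : C(unitInterval × A, X) := f.comp H.symm.toContinuousMap
  have hK (a : A) : K (0, a) = p (ContinuousMap.const A e a) := by
    simp [K, he, ContinuousMap.Homotopy.symm]
  refine ⟨(cov.liftHomotopy K (.const A e) hK).comp (.prodMk (.const A 1) (.id A)), fun a ↦ ?_⟩
  have := congr_fun (cov.liftHomotopy_lifts K (.const A e) hK) (1, a)
  simpa [K, ContinuousMap.Homotopy.symm] using this

lemma exists_int_forall_eq_add_mul {A : Type*} [TopologicalSpace A] [PreconnectedSpace A]
    {u v : A → ℝ} (hu : Continuous u) (hv : Continuous v) {c : ℝ} (hc : c ≠ 0)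
    (h : ∀ a, ∃ m : ℤ, u a = v a + m * c) : ∃ m : ℤ, ∀ a, u a = v a + m * c := by
  choose m hm using h
  have hcont : Continuous m := by
    rw [Int.isClosedEmbedding_coe_real.isEmbedding.continuous_iff]
    have : (fun a ↦ (u a - v a) / c) = Int.cast ∘ m := by
      ext a
      simp [hm a, hc]
    rw [← this]
    fun_prop
  rcases isEmpty_or_nonempty A with hA | ⟨⟨a₀⟩⟩
  · exact ⟨0, fun a ↦ (hA.false a).elim⟩
  · exact ⟨m a₀, fun a ↦ PreconnectedSpace.constant inferInstance hcont (x := a) (y := a₀) ▸ hm a⟩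

end Lifting

section Singular
variable (F : Type) [Field F]

/-- The functor of singular chains, with `(singularChains F).obj X = singularChainComplex F X`. -/
noncomputable def singularChains : TopCat.{0} ⥤ ChainComplex (ModuleCat F) ℕ :=
  TopCat.toSSet ⋙ (SimplicialObject.whiskering _ _).obj (ModuleCat.free F) ⋙
    AlgebraicTopology.alternatingFaceMapComplex (ModuleCat F)

variable {F} in
/-- A homotopy between continuous maps induces a chain homotopy on singular chains. -/
noncomputable def TopCat.Homotopy.singularChains {X Y : TopCat.{0}} {f g : X ⟶ Y}
    (H : TopCat.Homotopy f g) :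
    _root_.Homotopy ((singularChains F).map f) ((singularChains F).map g) :=
  (H.toSSet.toSimplicialObjectHomotopy.whiskerRight (ModuleCat.free F)).toChainHomotopy

lemma toSSetObjEquiv_map {X Y : TopCat.{0}} (f : X ⟶ Y) (n : SimplexCategoryᵒᵖ)
    (s : (TopCat.toSSet.obj X).obj n) :
    Y.toSSetObjEquiv n ((TopCat.toSSet.map f).app n s) = f.hom.comp (X.toSSetObjEquiv n s) := rfl

instance (n : ℕ) : ContractibleSpace (stdSimplex ℝ (Fin (n + 1))) :=
  (convex_stdSimplex ℝ _).contractibleSpace ⟨_, single_mem_stdSimplex ℝ 0⟩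

variable (Y Z : Type) [TopologicalSpace Y] [TopologicalSpace Z]

/-- Translation by `c` on the second factor of `Y × ℝ`. -/
noncomputable def deckTranslation (c : ℝ) : TopCat.of (Y × ℝ) ⟶ TopCat.of (Y × ℝ) :=
  TopCat.ofHom ⟨fun z ↦ (z.1, z.2 + c), by fun_prop⟩

/-- Translations of the second factor of `Y × ℝ` are homotopic to the identity. -/
noncomputable def deckTranslationHomotopy (c : ℝ) :
    TopCat.Homotopy (𝟙 (TopCat.of (Y × ℝ))) (deckTranslation Y c) where
  toFun z := (z.2.1, z.2.2 + z.1 * c)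
  continuous_toFun := by fun_prop
  map_zero_left z := by simp
  map_one_left z := by simp [deckTranslation]

variable {Z} in
/-- The product of the identity of `Y` and a map `q : ℝ → Z`. -/
def prodCover {q : ℝ → Z} (hq : Continuous q) : TopCat.of (Y × ℝ) ⟶ TopCat.of (Y × Z) :=
  TopCat.ofHom ⟨fun z ↦ (z.1, q z.2), by fun_prop⟩

lemma toSSetObjEquiv_iterate_deckTranslation (c : ℝ) (n : SimplexCategoryᵒᵖ)
    (s : (TopCat.toSSet.obj (TopCat.of (Y × ℝ))).obj n) (k : ℕ) (a) :
    (TopCat.of (Y × ℝ)).toSSetObjEquiv n (((TopCat.toSSet.map (deckTranslation Y c)).app n)^[k] s) a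
      = (((TopCat.of (Y × ℝ)).toSSetObjEquiv n s a).1,
        ((TopCat.of (Y × ℝ)).toSSetObjEquiv n s a).2 + k * c) := by
  induction k with
  | zero => simp
  | succ k ih =>
    rw [Function.iterate_succ_apply', toSSetObjEquiv_map]
    change deckTranslation Y c _ = _
    rw [ih]
    simp [deckTranslation]
    ring

variable {Y Z} {q : ℝ → Z} {c : ℝ}

lemma shortExact_free_toSSet_prodCover (hq : IsCoveringMap q) (hq' : Function.Surjective q)
    (hc : c ≠ 0) (hqc : ∀ x y, q x = q y ↔ ∃ m : ℤ, x = y + m * c) (n : SimplexCategoryᵒᵖ) :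
    Function.Injective (
        (LinearMap.id : ((TopCat.toSSet.obj (TopCat.of (Y × ℝ))).obj n →₀ F) →ₗ[F] _) -
        Finsupp.lmapDomain F F ((TopCat.toSSet.map (deckTranslation Y c)).app n)) ∧
      Function.Exact (
        (LinearMap.id : ((TopCat.toSSet.obj (TopCat.of (Y × ℝ))).obj n →₀ F) →ₗ[F] _) -
          Finsupp.lmapDomain F F ((TopCat.toSSet.map (deckTranslation Y c)).app n))
        (Finsupp.lmapDomain F F ((TopCat.toSSet.map (prodCover Y hq.continuous)).app n)) ∧
      Function.Surjective
        (Finsupp.lmapDomain F F ((TopCat.toSSet.map (prodCover Y hq.continuous)).app n)) := by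
  let e := (TopCat.of (Y × ℝ)).toSSetObjEquiv n
  let e' := (TopCat.of (Y × Z)).toSSetObjEquiv n
  have hsurj : Function.Surjective ((TopCat.toSSet.map (prodCover Y hq.continuous)).app n) := by
    intro s
    obtain ⟨g, hg⟩ := hq.exists_lift_of_contractibleSpace hq'
      (.comp ⟨Prod.snd, continuous_snd⟩ (e' s))
    refine ⟨e.symm (.prodMk (.comp ⟨Prod.fst, continuous_fst⟩ (e' s)) g), e'.injective ?_⟩
    rw [toSSetObjEquiv_map, Equiv.apply_symm_apply]
    refine ContinuousMap.ext fun a ↦ ?_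
    change ((e' s a).1, q (g a)) = e' s a
    rw [hg a]
    rfl
  have hfree (s) : Function.Injective
      fun k : ℕ ↦ ((TopCat.toSSet.map (deckTranslation Y c)).app n)^[k] s := by
    intro k l hkl
    have a : stdSimplex ℝ (Fin (n.unop.len + 1)) := Classical.arbitrary _
    have h := congr_arg (fun u ↦ e u a) hkl
    have h' := (toSSetObjEquiv_iterate_deckTranslation Y c n s k a).symm.trans
      (h.trans (toSSetObjEquiv_iterate_deckTranslation Y c n s l a))
    simpa [hc] using! congr_arg Prod.snd h'
  have hinj : Function.Injective ((TopCat.toSSet.map (deckTranslation Y c)).app n) := by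
    intro s s' h
    refine e.injective (ContinuousMap.ext fun a ↦ ?_)
    have := congr_arg (fun u ↦ e u a) h
    have h1 := toSSetObjEquiv_iterate_deckTranslation Y c n s 1 a
    have h2 := toSSetObjEquiv_iterate_deckTranslation Y c n s' 1 a
    have h3 := h1.symm.trans (this.trans h2)
    simpa [Prod.ext_iff] using! h3
  refine ⟨Finsupp.injective_id_sub_lmapDomain hinj hfree,
    Finsupp.exact_id_sub_lmapDomain hsurj (fun s ↦ ?_) (fun s s' h ↦ ?_),
    Finsupp.mapDomain_surjective hsurj⟩
  · refine e'.injective (ContinuousMap.ext fun a ↦ ?_)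
    exact Prod.ext rfl ((hqc _ _).2 ⟨1, by simp; rfl⟩)
  · have h (a) := DFunLike.congr_fun (congr_arg e' h) a
    obtain ⟨m, hm⟩ := exists_int_forall_eq_add_mul
      (u := fun a ↦ (e s' a).2) (v := fun a ↦ (e s a).2) (by fun_prop) (by fun_prop) hc
      fun a ↦ (hqc _ _).1 (congr_arg Prod.snd (h a)).symm
    have h1 (a) : (e s a).1 = (e s' a).1 := by
      have := congr_arg Prod.fst (h a)
      exact this
    obtain ⟨k, rfl | rfl⟩ := m.eq_nat_or_neg
    · refine ⟨k, .inl (e.injective (ContinuousMap.ext fun a ↦ ?_))⟩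
      refine (toSSetObjEquiv_iterate_deckTranslation Y c n s k a).trans (Prod.ext (h1 a) ?_)
      simpa using (hm a).symm
    · refine ⟨k, .inr (e.injective (ContinuousMap.ext fun a ↦ ?_))⟩
      refine (toSSetObjEquiv_iterate_deckTranslation Y c n s' k a).trans (Prod.ext (h1 a).symm ?_)
      have := hm a
      push_cast at this
      change (e s' a).2 + k * c = (e s a).2
      rw [this]; ring

variable (Y) in
/-- The short complex of singular chains of an infinite cyclic covering. -/
noncomputable def wangShortComplex (hq : Continuous q) (hqc : ∀ x, q (x + c) = q x) :
    ShortComplex (ChainComplex (ModuleCat F) ℕ) where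
  f := 𝟙 _ - (singularChains F).map (deckTranslation Y c)
  g := (singularChains F).map (prodCover Y hq)
  zero := by
    have h : deckTranslation Y c ≫ prodCover Y hq = prodCover Y hq := by
      refine TopCat.hom_ext (ContinuousMap.ext fun z ↦ ?_)
      exact congr_arg (Prod.mk (Prod.fst z)) (hqc (Prod.snd z))
    rw [Preadditive.sub_comp, Category.id_comp, ← Functor.map_comp, h, sub_self]

lemma wangShortComplex_shortExact (hq : IsCoveringMap q) (hq' : Function.Surjective q)
    (hc : c ≠ 0) (hqc : ∀ x y, q x = q y ↔ ∃ m : ℤ, x = y + m * c)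
    (hqc' : ∀ x, q (x + c) = q x) :
    (wangShortComplex F Y hq.continuous hqc').ShortExact := by
  refine HomologicalComplex.shortExact_of_degreewise_shortExact _ fun n ↦ ?_
  obtain ⟨h1, h2, h3⟩ := shortExact_free_toSSet_prodCover F (Y := Y) hq hq' hc hqc (.op (.mk n))
  exact ModuleCat.shortComplex_shortExact _ h2 h1 h3

lemma wangShortComplex_homologyMap_f (hq : Continuous q) (hqc : ∀ x, q (x + c) = q x) (n : ℕ) :
    HomologicalComplex.homologyMap (wangShortComplex F Y hq hqc).f n = 0 := by
  have := ((deckTranslationHomotopy Y c).singularChains (F := F)).homologyMap_eq n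
  rw [CategoryTheory.Functor.map_id] at this
  rw [wangShortComplex, HomologicalComplex.homologyMap_sub, this, sub_self]

end Singular

lemma HomologicalComplex.shortExact_homology_of_homologyMap_eq_zero {C : Type*} [Category* C]
    [Abelian C] {ι : Type*}
    {c : ComplexShape ι} {S : ShortComplex (HomologicalComplex C c)} (hS : S.ShortExact)
    (hf : ∀ n, HomologicalComplex.homologyMap S.f n = 0) (i j : ι) (hij : c.Rel i j) :
    (ShortComplex.mk _ _ (hS.comp_δ i j hij)).ShortExact where
  exact := hS.homology_exact₃ i j hij
  mono_f := (hS.homology_exact₂ i).mono_g (hf i)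
  epi_g := (hS.homology_exact₁ i j hij).epi_f (hf j)

lemma isIso_homologyMap_zero_of_homologyMap_eq_zero {C : Type*} [Category* C] [Abelian C]
    {S : ShortComplex (ChainComplex C ℕ)} (hS : S.ShortExact)
    (hf : ∀ n, HomologicalComplex.homologyMap S.f n = 0) :
    IsIso (HomologicalComplex.homologyMap S.g 0) := by
  have : Mono (HomologicalComplex.homologyMap S.g 0) := (hS.homology_exact₂ 0).mono_g (hf 0)
  have := hS.epi_g
  have : Epi (HomologicalComplex.homologyMap S.g 0) := by
    have h := HomologicalComplex.homologyι_naturality S.g 0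
    rw [← IsIso.eq_comp_inv] at h
    rw [h]
    infer_instance
  exact isIso_of_mono_of_epi _

section
variable (F : Type) [Field F] {X Y Z : Type} [TopologicalSpace X] [TopologicalSpace Y]
  [TopologicalSpace Z]

open ContinuousMap in
lemma singularHomology_equiv_of_homotopyEquiv (e : X ≃ₕ Y) (n : ℕ) :
    Nonempty (singularHomology F X n ≃ₗ[F] singularHomology F Y n) := by
  let f := (singularChains F).map (TopCat.ofHom e.toFun)
  let g := (singularChains F).map (TopCat.ofHom e.invFun)
  obtain ⟨H₁⟩ := e.left_inv
  obtain ⟨H₂⟩ := e.right_inv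
  have h₁ := (TopCat.Homotopy.singularChains (F := F)
    (f := TopCat.ofHom e.toFun ≫ TopCat.ofHom e.invFun) (g := 𝟙 _) H₁).homologyMap_eq n
  have h₂ := (TopCat.Homotopy.singularChains (F := F)
    (f := TopCat.ofHom e.invFun ≫ TopCat.ofHom e.toFun) (g := 𝟙 _) H₂).homologyMap_eq n
  rw [CategoryTheory.Functor.map_id, Functor.map_comp, HomologicalComplex.homologyMap_comp,
    HomologicalComplex.homologyMap_id] at h₁ h₂
  exact ⟨(Iso.mk (HomologicalComplex.homologyMap f n) (HomologicalComplex.homologyMap g n)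
    h₁ h₂).toLinearEquiv⟩

lemma singularHomology_prod_real_equiv (n : ℕ) :
    Nonempty (singularHomology F (Y × ℝ) n ≃ₗ[F] singularHomology F Y n) :=
  singularHomology_equiv_of_homotopyEquiv F
    (((ContinuousMap.HomotopyEquiv.refl Y).prodCongr (ContractibleSpace.hequiv ℝ Unit).some).trans
      (Homeomorph.prodUnique Y Unit).toHomotopyEquiv) n

lemma exists_linearEquiv_prod_of_shortExact {S : ShortComplex (ModuleCat F)} (hS : S.ShortExact) :
    Nonempty (S.X₂ ≃ₗ[F] S.X₁ × S.X₃) := by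
  obtain ⟨l, hl⟩ := S.g.hom.exists_rightInverse_of_surjective
    (LinearMap.range_eq_top.2 hS.moduleCat_surjective_g)
  have h := (ShortComplex.ShortExact.moduleCat_exact_iff_function_exact S).1 hS.exact
  exact ⟨(h.splitSurjectiveEquiv hS.moduleCat_injective_f ⟨l, hl⟩).1⟩

/-- If `q : ℝ → Z` is an infinite cyclic covering, then `H₀(Y × Z) ≅ H₀(Y)`. -/
lemma singularHomology_prod_zero_equiv {q : ℝ → Z} {c : ℝ} (hq : IsCoveringMap q)
    (hq' : Function.Surjective q) (hc : c ≠ 0)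
    (hqc : ∀ x y, q x = q y ↔ ∃ m : ℤ, x = y + m * c) :
    Nonempty (singularHomology F (Y × Z) 0 ≃ₗ[F] singularHomology F Y 0) := by
  have hqc' (x : ℝ) : q (x + c) = q x := (hqc _ _).2 ⟨1, by simp⟩
  have := isIso_homologyMap_zero_of_homologyMap_eq_zero
    (wangShortComplex_shortExact F (Y := Y) hq hq' hc hqc hqc')
    (wangShortComplex_homologyMap_f F hq.continuous hqc')
  obtain ⟨e⟩ := singularHomology_prod_real_equiv F (Y := Y) 0
  exact ⟨(asIso (HomologicalComplex.homologyMap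
    (wangShortComplex F Y hq.continuous hqc').g 0)).toLinearEquiv.symm.trans e⟩

/-- If `q : ℝ → Z` is an infinite cyclic covering, then `Hₙ₊₁(Y × Z) ≅ Hₙ₊₁(Y) × Hₙ(Y)`. -/
lemma singularHomology_prod_succ_equiv {q : ℝ → Z} {c : ℝ} (hq : IsCoveringMap q)
    (hq' : Function.Surjective q) (hc : c ≠ 0)
    (hqc : ∀ x y, q x = q y ↔ ∃ m : ℤ, x = y + m * c)
    (n : ℕ) :
    Nonempty (singularHomology F (Y × Z) (n + 1) ≃ₗ[F]
      singularHomology F Y (n + 1) × singularHomology F Y n) := by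
  have hqc' (x : ℝ) : q (x + c) = q x := (hqc _ _).2 ⟨1, by simp⟩
  have h := HomologicalComplex.shortExact_homology_of_homologyMap_eq_zero
    (wangShortComplex_shortExact F (Y := Y) hq hq' hc hqc hqc')
    (wangShortComplex_homologyMap_f F hq.continuous hqc') (n + 1) n rfl
  obtain ⟨e⟩ := exists_linearEquiv_prod_of_shortExact F h
  obtain ⟨e₁⟩ := singularHomology_prod_real_equiv F (Y := Y) (n + 1)
  obtain ⟨e₂⟩ := singularHomology_prod_real_equiv F (Y := Y) n
  exact ⟨e.trans (e₁.prodCongr e₂)⟩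

/-- The singular chain complex of a totally disconnected space is an alternating complex of
zero and identity maps. -/
noncomputable def singularChainComplexIsoAlternatingConst (X : Type) [TopologicalSpace X]
    [TotallyDisconnectedSpace X] :
    singularChainComplex F X ≅
      ChainComplex.alternatingConst.obj ((ModuleCat.free F).obj X) :=
  (AlgebraicTopology.alternatingFaceMapComplex _).mapIso
    (((SimplicialObject.whiskering _ _).obj (ModuleCat.free F)).mapIso
      (TopCat.toSSetIsoConst (TopCat.of X)) ≪≫ Functor.constComp _ _ _) ≪≫
    AlgebraicTopology.alternatingFaceMapComplexConst.app _

lemma singularHomology_unit_zero : Nonempty (singularHomology F Unit 0 ≃ₗ[F] F) :=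
  ⟨((HomologicalComplex.homologyFunctor _ _ 0).mapIso
      (singularChainComplexIsoAlternatingConst F Unit) ≪≫
    ChainComplex.alternatingConstHomologyZero _).toLinearEquiv.trans
      (Finsupp.uniqueLinearEquiv F F ())⟩

lemma singularHomology_unit_succ (n : ℕ) : Subsingleton (singularHomology F Unit (n + 1)) :=
  ModuleCat.isZero_iff_subsingleton.1
    (HomologicalComplex.ExactAt.of_iso (ChainComplex.alternatingConst_exactAt _ _ n.succ_ne_zero)
      (singularChainComplexIsoAlternatingConst F Unit).symm).isZero_homology

end

/-- The unit circle in `ℂ` is homeomorphic to the unit sphere of the Euclidean plane. -/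
noncomputable def circleHomeomorphSphere :
    Circle ≃ₜ Metric.sphere (0 : EuclideanSpace ℝ (Fin 2)) 1 :=
  Complex.orthonormalBasisOneI.repr.toHomeomorph.subtype fun z ↦ by
    rw [← SetLike.mem_coe]
    simp [Submonoid.unitSphere]

/-- Let `F` be a field.  For the torus `S^1 × S^1`, singular
homology with coefficients in `F` satisfies `H_0 ≅ F`, `H_1 ≅ F ⊕ F`, `H_2 ≅ F`,
and `H_r = 0` for all `r ≥ 3`. -/
theorem singularHomology_torus (F : Type) [Field F] :
    Nonempty ((singularHomology F
        ((Metric.sphere (0 : EuclideanSpace ℝ (Fin 2)) 1) ×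
          (Metric.sphere (0 : EuclideanSpace ℝ (Fin 2)) 1)) 0) ≃ₗ[F] F) ∧
    Nonempty ((singularHomology F
        ((Metric.sphere (0 : EuclideanSpace ℝ (Fin 2)) 1) ×
          (Metric.sphere (0 : EuclideanSpace ℝ (Fin 2)) 1)) 1) ≃ₗ[F] (F × F)) ∧
    Nonempty ((singularHomology F
        ((Metric.sphere (0 : EuclideanSpace ℝ (Fin 2)) 1) ×
          (Metric.sphere (0 : EuclideanSpace ℝ (Fin 2)) 1)) 2) ≃ₗ[F] F) ∧
    (∀ r : ℕ, 3 ≤ r →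
      Subsingleton (singularHomology F
        ((Metric.sphere (0 : EuclideanSpace ℝ (Fin 2)) 1) ×
          (Metric.sphere (0 : EuclideanSpace ℝ (Fin 2)) 1)) r)) := by
  set T := Metric.sphere (0 : EuclideanSpace ℝ (Fin 2)) 1
  let q : ℝ → T := circleHomeomorphSphere ∘ Circle.exp
  have hq : IsCoveringMap q := Circle.isCoveringMap_exp.homeomorph_comp _
  have hq' : Function.Surjective q :=
    circleHomeomorphSphere.surjective.comp Circle.exp_surjective
  have hc : 2 * Real.pi ≠ 0 := Real.two_pi_pos.ne'
  have hqc (x y : ℝ) : q x = q y ↔ ∃ m : ℤ, x = y + m * (2 * Real.pi) :=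
    circleHomeomorphSphere.injective.eq_iff.trans Circle.exp_eq_exp
  have hcirc (n : ℕ) : Nonempty (singularHomology F T n ≃ₗ[F] singularHomology F (Unit × T) n) :=
    singularHomology_equiv_of_homotopyEquiv F (Homeomorph.uniqueProd Unit T).symm.toHomotopyEquiv n
  have hunit := singularHomology_unit_succ F
  obtain ⟨u₀⟩ := singularHomology_unit_zero F
  have h₀ : Nonempty (singularHomology F T 0 ≃ₗ[F] F) := by
    obtain ⟨a⟩ := hcirc 0
    obtain ⟨b⟩ := singularHomology_prod_zero_equiv F (Y := Unit) hq hq' hc hqc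
    exact ⟨a ≪≫ₗ b ≪≫ₗ u₀⟩
  have h₁ : Nonempty (singularHomology F T 1 ≃ₗ[F] F) := by
    obtain ⟨a⟩ := hcirc 1
    obtain ⟨b⟩ := singularHomology_prod_succ_equiv F (Y := Unit) hq hq' hc hqc 0
    have := hunit 0
    have : Unique (singularHomology F Unit (0 + 1)) := uniqueOfSubsingleton 0
    exact ⟨a ≪≫ₗ b ≪≫ₗ LinearEquiv.uniqueProd ≪≫ₗ u₀⟩
  have h₂ (n : ℕ) : Subsingleton (singularHomology F T (n + 2)) := by
    obtain ⟨a⟩ := hcirc (n + 2)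
    obtain ⟨b⟩ := singularHomology_prod_succ_equiv F (Y := Unit) hq hq' hc hqc (n + 1)
    have := hunit n
    have := hunit (n + 1)
    exact (a ≪≫ₗ b).toEquiv.subsingleton
  obtain ⟨e₀⟩ := h₀
  obtain ⟨e₁⟩ := h₁
  refine ⟨?_, ?_, ?_, fun r hr ↦ ?_⟩
  · obtain ⟨b⟩ := singularHomology_prod_zero_equiv F (Y := T) hq hq' hc hqc
    exact ⟨b ≪≫ₗ e₀⟩
  · obtain ⟨b⟩ := singularHomology_prod_succ_equiv F (Y := T) hq hq' hc hqc 0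
    exact ⟨b ≪≫ₗ e₁.prodCongr e₀⟩
  · obtain ⟨b⟩ := singularHomology_prod_succ_equiv F (Y := T) hq hq' hc hqc 1
    have := h₂ 0
    have : Unique (singularHomology F T (1 + 1)) := uniqueOfSubsingleton 0
    exact ⟨b ≪≫ₗ LinearEquiv.uniqueProd ≪≫ₗ e₁⟩
  · obtain ⟨n, rfl⟩ := Nat.exists_eq_add_of_le' hr
    obtain ⟨b⟩ := singularHomology_prod_succ_equiv F (Y := T) hq hq' hc hqc (n + 2)
    have := h₂ n
    have := h₂ (n + 1)
    exact b.toEquiv.subsingleton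
end
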